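/- arXiv:1907.13558 — 2 statements merged into one kernel-verified Lean document; each statement's English description precedes it below -/
import Mathlib

section
/- Let G be an embedded proper level-planar graph on levels 1, …, k, let λ ≥ 1, and suppose that the rightmost vertices of the levels form a directed path p_R in G with one vertex on each level from 1 to k; let v_R be the vertex of p_R on level 1. Then every vertex of G is reachable from v_R by a directed walk in the constraint digraph D_G^λ. Moreover, if D_G^λ contains no directed cycle of negative total length, then d(v), defined as the minimum total arc length of a directed walk from v_R to v in D_G^λ, is well-defined for all v ∈ V, the function d is a distance labeling of D_G^λ (so v ↦ (d(v), ℓ(v)) is a λ-drawing of G), and every distance labeling x of D_G^λ with x(v_R) = 0 satisfies x(v) ≤ d(v) for all v ∈ V; in particular, every λ-drawing Γ of G with Γ(v_R) = 0 satisfies Γ(v) ≤ d(v) for all v ∈ V, i.e., d describes the λ-rightmost drawing of G. -/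
/-- The point in the plane at which vertex `v` with x-coordinate `Γ v` is drawn:
levels serve as y-coordinates. -/
def levelPt {V : Type*} (Γ : V → ℝ) (lv : V → ℕ) (v : V) : ℝ × ℝ :=
  (Γ v, (lv v : ℝ))

/-- The closed straight-line segment representing the edge `(u, v)`. -/
def edgeSeg {V : Type*} (Γ : V → ℝ) (lv : V → ℕ) (u v : V) : Set (ℝ × ℝ) :=
  segment ℝ (levelPt Γ lv u) (levelPt Γ lv v)

/-- A straight-line level drawing `Γ` of the level graph with edge relation `E` and level
assignment `lv` is level-planar if any point lying on the segments of two distinct edges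
is a common endpoint of the two segments. -/
def LevelPlanar {V : Type*} (E : V → V → Prop) (Γ : V → ℝ) (lv : V → ℕ) : Prop :=
  ∀ u v w x, E u v → E w x → (u, v) ≠ (w, x) →
    ∀ p, p ∈ edgeSeg Γ lv u v → p ∈ edgeSeg Γ lv w x →
      (p = levelPt Γ lv u ∨ p = levelPt Γ lv v) ∧ (p = levelPt Γ lv w ∨ p = levelPt Γ lv x)

/-- The slope of the edge `(u, v)` in the drawing `Γ`. -/
noncomputable def slopeOf {V : Type*} (Γ : V → ℝ) (lv : V → ℕ) (u v : V) : ℝ :=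
  (Γ v - Γ u) / ((lv v : ℝ) - (lv u : ℝ))

/-- The integer `xbar` is a gap in the integer-coordinate drawing `Γ`. -/
def IsGap {V : Type*} (E : V → V → Prop) (Γ : V → ℤ) (xbar : ℤ) : Prop :=
  (∀ v, Γ v ≠ xbar) ∧ (∃ v₁, Γ v₁ < xbar) ∧ (∃ v₂, xbar < Γ v₂) ∧
    ∀ u v, E u v → ¬ (min (Γ u) (Γ v) < xbar ∧ xbar < max (Γ u) (Γ v))

/-- A drawing is compact if it has no gap. -/
def CompactDrawing {V : Type*} (E : V → V → Prop) (Γ : V → ℤ) : Prop :=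
  ¬ ∃ xbar : ℤ, IsGap E Γ xbar

/-- `emb` is an embedding of the proper level graph `(E, lv)`: a family of total orders, one
on each level, such that no two edges interleave. -/
structure IsLevelEmbedding {V : Type*} (E : V → V → Prop) (lv : V → ℕ)
    (emb : V → V → Prop) : Prop where
  same_level : ∀ u v, emb u v → lv u = lv v
  irrefl : ∀ u, ¬ emb u u
  trans : ∀ u v w, emb u v → emb v w → emb u w
  total : ∀ u v, lv u = lv v → u ≠ v → emb u v ∨ emb v u
  no_interleave : ∀ u v w x, E u w → E v x → emb u v → ¬ emb x w

/-- `u` and `v` are consecutive vertices on a common level: `u ≺ v` and no vertex lies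
strictly between them. -/
def ConsecVert {V : Type*} (emb : V → V → Prop) (u v : V) : Prop :=
  emb u v ∧ ¬ ∃ z, emb u z ∧ emb z v

/-- `Γ` is a λ-drawing of the embedded proper level-planar graph `(E, lv, emb)`:
an embedding-preserving level-planar straight-line level drawing with integer x-coordinates
in which every edge has slope in `{0, 1, …, λ - 1}`. -/
def IsLamDrawing {V : Type*} (E : V → V → Prop) (lv : V → ℕ) (emb : V → V → Prop)
    (lam : ℕ) (Γ : V → ℤ) : Prop :=
  (∀ u v, lv u = lv v → (emb u v ↔ Γ u < Γ v)) ∧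
  (∀ u v, E u v → 0 ≤ Γ v - Γ u ∧ Γ v - Γ u ≤ (lam : ℤ) - 1) ∧
  LevelPlanar E (fun v => (Γ v : ℝ)) lv

/-- `x` is a distance labeling of the constraint digraph `D_G^λ`: for every arc `(a, b)` of
length `ℓ` we have `x b ≤ x a + ℓ`.  The arcs are: `(u, v)` of length `λ - 1` and `(v, u)` of
length `0` for every edge `(u, v)`, and `(v, u)` of length `-1` for consecutive `u ≺ v`. -/
def IsDistanceLabeling {V : Type*} (E : V → V → Prop) (emb : V → V → Prop)
    (lam : ℕ) (x : V → ℤ) : Prop :=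
  (∀ u v, E u v → x v ≤ x u + ((lam : ℤ) - 1) ∧ x u ≤ x v + 0) ∧
  (∀ u v, ConsecVert emb u v → x u ≤ x v + (-1))

/-- Directed walks in the constraint digraph `D_G^λ`, recording the start vertex, the end
vertex, the number of arcs, and the total arc length. -/
inductive DWalk {V : Type*} (E : V → V → Prop) (emb : V → V → Prop) (lam : ℕ) :
    V → V → ℕ → ℤ → Prop
  | refl (v : V) : DWalk E emb lam v v 0 0
  | edgeFwd {u v w : V} {n : ℕ} {L : ℤ} :
      DWalk E emb lam u v n L → E v w → DWalk E emb lam u w (n + 1) (L + ((lam : ℤ) - 1))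
  | edgeBack {u v w : V} {n : ℕ} {L : ℤ} :
      DWalk E emb lam u v n L → E w v → DWalk E emb lam u w (n + 1) (L + 0)
  | consecArc {u v w : V} {n : ℕ} {L : ℤ} :
      DWalk E emb lam u v n L → ConsecVert emb w v → DWalk E emb lam u w (n + 1) (L + (-1))

/-- The constraint digraph `D_G^λ` contains no directed cycle of negative total length. -/
def NoNegCycle {V : Type*} (E : V → V → Prop) (emb : V → V → Prop) (lam : ℕ) : Prop :=
  ¬ ∃ (v : V) (n : ℕ) (L : ℤ), 0 < n ∧ DWalk E emb lam v v n L ∧ L < 0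

/-- The arcs of the constraint digraph, with their lengths. -/
inductive ConstraintArc {V : Type*} (E : V → V → Prop) (emb : V → V → Prop) (lam : ℕ) :
    V → V → ℤ → Prop
  | edgeFwd {v w : V} : E v w → ConstraintArc E emb lam v w ((lam : ℤ) - 1)
  | edgeBack {v w : V} : E w v → ConstraintArc E emb lam v w 0
  | consecArc {v w : V} : ConsecVert emb w v → ConstraintArc E emb lam v w (-1)

section ConstraintDigraph

variable {V : Type*} {E : V → V → Prop} {lv : V → ℕ} {emb : V → V → Prop} {lam : ℕ}

theorem DWalk.snoc {u v w : V} {n : ℕ} {L l : ℤ} (h : DWalk E emb lam u v n L)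
    (a : ConstraintArc E emb lam v w l) : DWalk E emb lam u w (n + 1) (L + l) := by
  cases a with
  | edgeFwd e => exact h.edgeFwd e
  | edgeBack e => exact h.edgeBack e
  | consecArc c => exact h.consecArc c

theorem DWalk.arc_induction {u : V} {P : V → ℤ → Prop} (refl : P u 0)
    (snoc : ∀ {v w : V} {L l : ℤ}, P v L → ConstraintArc E emb lam v w l → P w (L + l))
    {v : V} {n : ℕ} {L : ℤ} (h : DWalk E emb lam u v n L) : P v L := by
  induction h with
  | refl => exact refl
  | edgeFwd _ e ih => exact snoc ih (.edgeFwd e)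
  | edgeBack _ e ih => exact snoc ih (.edgeBack e)
  | consecArc _ c ih => exact snoc ih (.consecArc c)

theorem ConstraintArc.neg_one_le {v w : V} {l : ℤ} (hlam : 1 ≤ lam)
    (a : ConstraintArc E emb lam v w l) : -1 ≤ l := by
  cases a <;> omega

theorem isDistanceLabeling_iff {x : V → ℤ} :
    IsDistanceLabeling E emb lam x ↔
      ∀ a b l, ConstraintArc E emb lam a b l → x b ≤ x a + l := by
  constructor
  · rintro ⟨hedge, hconsec⟩ a b l (e | e | c)
    · exact (hedge _ _ e).1
    · exact (hedge _ _ e).2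
    · exact hconsec _ _ c
  · exact fun h => ⟨fun u v e => ⟨h _ _ _ (.edgeFwd e), h _ _ _ (.edgeBack e)⟩,
      fun u v c => h _ _ _ (.consecArc c)⟩

theorem IsDistanceLabeling.le_add_of_walk {x : V → ℤ} (hx : IsDistanceLabeling E emb lam x)
    {u v : V} {n : ℕ} {L : ℤ} (h : DWalk E emb lam u v n L) : x v ≤ x u + L := by
  refine h.arc_induction (P := fun v L => x v ≤ x u + L) (by simp) fun {v w L l} ih a => ?_
  have := isDistanceLabeling_iff.1 hx _ _ _ a
  omega

/-- `PathWalk E emb lam u S v L`: there is a walk from `u` to `v` of total length `L` that visits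
each vertex of `S` exactly once and no other vertex. -/
inductive PathWalk [DecidableEq V] (E : V → V → Prop) (emb : V → V → Prop) (lam : ℕ) (u : V) :
    Finset V → V → ℤ → Prop
  | refl : PathWalk E emb lam u {u} u 0
  | snoc {S : Finset V} {v w : V} {L l : ℤ} : PathWalk E emb lam u S v L →
      ConstraintArc E emb lam v w l → w ∉ S → PathWalk E emb lam u (insert w S) w (L + l)

theorem PathWalk.neg_card_le [DecidableEq V] (hlam : 1 ≤ lam) {u v : V} {S : Finset V} {L : ℤ}
    (h : PathWalk E emb lam u S v L) : -(S.card : ℤ) ≤ L := by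
  induction h with
  | refl => simp
  | snoc _ a hw ih =>
    have := a.neg_one_le hlam
    rw [Finset.card_insert_of_notMem hw]
    push_cast
    omega

theorem PathWalk.exists_split [DecidableEq V] {u v : V} {S : Finset V} {L : ℤ}
    (h : PathWalk E emb lam u S v L) {s : V} (hs : s ∈ S) :
    ∃ T L₁ L₂ n, PathWalk E emb lam u T s L₁ ∧ DWalk E emb lam s v n L₂ ∧ L₁ + L₂ = L := by
  induction h with
  | refl =>
    obtain rfl := Finset.mem_singleton.1 hs
    exact ⟨_, _, _, _, .refl, .refl _, add_zero 0⟩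
  | snoc h a hw ih =>
    rcases Finset.mem_insert.1 hs with rfl | hs
    · exact ⟨_, _, _, _, .snoc h a hw, .refl _, add_zero _⟩
    · obtain ⟨T, L₁, L₂, n, hT, hd, rfl⟩ := ih hs
      exact ⟨T, L₁, _, _, hT, hd.snoc a, (add_assoc _ _ _).symm⟩

theorem DWalk.exists_pathWalk_le [DecidableEq V] (hneg : NoNegCycle E emb lam) {u v : V} {n : ℕ}
    {L : ℤ} (h : DWalk E emb lam u v n L) : ∃ S L', PathWalk E emb lam u S v L' ∧ L' ≤ L := by
  refine h.arc_induction (P := fun v L => ∃ S L', PathWalk E emb lam u S v L' ∧ L' ≤ L)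
    ⟨_, _, .refl, le_rfl⟩ ?_
  rintro v w L l ⟨S, L', hS, hL⟩ a
  by_cases hw : w ∈ S
  · obtain ⟨T, L₁, L₂, n, hT, hd, rfl⟩ := hS.exists_split hw
    have hcycle : 0 ≤ L₂ + l :=
      not_lt.1 fun hlt => hneg ⟨w, n + 1, _, n.succ_pos, hd.snoc a, hlt⟩
    exact ⟨T, L₁, hT, by omega⟩
  · exact ⟨_, _, hS.snoc a hw, by omega⟩

theorem DWalk.neg_card_le [Fintype V] (hlam : 1 ≤ lam) (hneg : NoNegCycle E emb lam) {u v : V}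
    {n : ℕ} {L : ℤ} (h : DWalk E emb lam u v n L) : -(Fintype.card V : ℤ) ≤ L := by
  classical
  obtain ⟨S, L', hS, hL⟩ := h.exists_pathWalk_le hneg
  have := hS.neg_card_le hlam
  have := S.card_le_univ
  omega

theorem IsLevelEmbedding.wellFounded_gt [Finite V] (hemb : IsLevelEmbedding E lv emb) :
    WellFounded fun a b => emb b a :=
  haveI : IsTrans V fun a b => emb b a := ⟨fun _ _ _ h₁ h₂ => hemb.trans _ _ _ h₂ h₁⟩
  haveI : Std.Irrefl fun a b => emb b a := ⟨hemb.irrefl⟩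
  Finite.wellFounded_of_trans_of_irrefl _

theorem IsLevelEmbedding.wellFounded_lt [Finite V] (hemb : IsLevelEmbedding E lv emb) :
    WellFounded emb :=
  haveI : IsTrans V emb := ⟨hemb.trans⟩
  haveI : Std.Irrefl emb := ⟨hemb.irrefl⟩
  Finite.wellFounded_of_trans_of_irrefl _

theorem IsLevelEmbedding.exists_consecVert [Finite V] (hemb : IsLevelEmbedding E lv emb)
    {u v : V} (h : emb u v) : ∃ z, ConsecVert emb u z ∧ (z = v ∨ emb z v) := by
  obtain ⟨z, hz, hmin⟩ := hemb.wellFounded_lt.has_min {z | emb u z} ⟨v, h⟩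
  refine ⟨z, ⟨hz, fun ⟨y, huy, hyz⟩ => hmin y huy hyz⟩, ?_⟩
  by_contra! hne
  rcases hemb.total z v ((hemb.same_level _ _ hz).symm.trans (hemb.same_level _ _ h)) hne.1
    with hzv | hvz
  · exact hne.2 hzv
  · exact hmin v h hvz

theorem exists_dWalk_of_emb [Finite V] (hemb : IsLevelEmbedding E lv emb) {r t : V} {n : ℕ} {L : ℤ}
    (ht : DWalk E emb lam r t n L) (v : V) (hv : emb v t) :
    ∃ n L, DWalk E emb lam r v n L := by
  induction v using hemb.wellFounded_gt.induction with
  | _ v ih =>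
    obtain ⟨z, hz, rfl | hzt⟩ := hemb.exists_consecVert hv
    · exact ⟨_, _, ht.consecArc hz⟩
    · obtain ⟨_, _, hd⟩ := ih z hz.1 hzt
      exact ⟨_, _, hd.consecArc hz⟩

theorem IsDistanceLabeling.lt_of_emb [Finite V] (hemb : IsLevelEmbedding E lv emb) {x : V → ℤ}
    (hx : IsDistanceLabeling E emb lam x) {u v : V} (h : emb u v) : x u < x v := by
  induction u using hemb.wellFounded_gt.induction with
  | _ u ih =>
    obtain ⟨z, hz, hzv⟩ := hemb.exists_consecVert h
    have hstep := hx.2 _ _ hz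
    rcases hzv with rfl | hzv
    · omega
    · have := ih z hz.1 hzv
      omega

theorem IsLevelEmbedding.emb_iff_lt (hemb : IsLevelEmbedding E lv emb) {x : V → ℤ}
    (hx : ∀ u v, emb u v → x u < x v) {u v : V} (h : lv u = lv v) : emb u v ↔ x u < x v := by
  refine ⟨hx u v, fun hlt => ?_⟩
  rcases hemb.total u v h (by rintro rfl; exact lt_irrefl _ hlt) with huv | hvu
  · exact huv
  · exact absurd (hx v u hvu) hlt.asymm

/-- If two edges between the same two levels, parametrized by height, meet at parameter `s`,
then `s` is an endpoint of the unit interval. -/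
theorem IsLevelEmbedding.param_eq_zero_or_one (hemb : IsLevelEmbedding E lv emb) {Γ : V → ℝ}
    (hΓ : ∀ u v, emb u v → Γ u < Γ v) (hE : ∀ u v, E u v → lv v = lv u + 1) {u v w x : V}
    (huv : E u v) (hwx : E w x) (hne : (u, v) ≠ (w, x)) (hlv : lv u = lv w) {s : ℝ}
    (hs0 : 0 ≤ s) (hs1 : s ≤ 1) (h : (1 - s) * Γ u + s * Γ v = (1 - s) * Γ w + s * Γ x) :
    s = 0 ∨ s = 1 := by
  have hends : lv v = lv x := by rw [hE _ _ huv, hE _ _ hwx, hlv]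
  have hle : ∀ {a b c d}, E a b → E c d → lv b = lv d → emb a c → Γ b ≤ Γ d := by
    intro a b c d hab hcd hbd hac
    by_cases hbd' : b = d
    · rw [hbd']
    · rcases hemb.total b d hbd hbd' with hlt | hgt
      · exact (hΓ _ _ hlt).le
      · exact absurd hgt (hemb.no_interleave _ _ _ _ hab hcd hac)
  rcases eq_or_ne u w with rfl | huw
  · have hvx : v ≠ x := fun hvx => hne (by rw [hvx])
    have hΓne : Γ v ≠ Γ x := by
      rcases hemb.total v x hends hvx with hlt | hgt
      · exact (hΓ _ _ hlt).ne
      · exact (hΓ _ _ hgt).ne'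
    exact Or.inl ((mul_eq_zero.1 (show s * (Γ v - Γ x) = 0 by linarith)).resolve_right
      (sub_ne_zero.2 hΓne))
  · right
    by_contra hs
    have hpos : 0 < 1 - s := sub_pos.2 (lt_of_le_of_ne hs1 hs)
    rcases hemb.total u w hlv huw with hlt | hgt
    · have h1 := mul_lt_mul_of_pos_left (hΓ _ _ hlt) hpos
      have h2 := mul_le_mul_of_nonneg_left (hle huv hwx hends hlt) hs0
      linarith
    · have h1 := mul_lt_mul_of_pos_left (hΓ _ _ hgt) hpos
      have h2 := mul_le_mul_of_nonneg_left (hle hwx huv hends.symm hgt) hs0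
      linarith

theorem mem_edgeSeg_iff {Γ : V → ℝ} {u v : V} (huv : lv v = lv u + 1) {q : ℝ × ℝ} :
    q ∈ edgeSeg Γ lv u v ↔
      ∃ s : ℝ, 0 ≤ s ∧ s ≤ 1 ∧ q = ((1 - s) * Γ u + s * Γ v, lv u + s) := by
  rw [edgeSeg, segment_eq_image]
  simp only [Set.mem_image, Set.mem_Icc, levelPt, huv, Prod.smul_mk, Prod.mk_add_mk, smul_eq_mul]
  have hy : ∀ s : ℝ, (1 - s) * (lv u : ℝ) + s * ((lv u + 1 : ℕ) : ℝ) = lv u + s := by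
    intro s
    push_cast
    ring
  simp only [hy, and_assoc, eq_comm]

theorem IsLevelEmbedding.levelPlanar (hemb : IsLevelEmbedding E lv emb) {Γ : V → ℝ}
    (hΓ : ∀ u v, emb u v → Γ u < Γ v) (hE : ∀ u v, E u v → lv v = lv u + 1) :
    LevelPlanar E Γ lv := by
  intro u v w x huv hwx hne q hq₁ hq₂
  obtain ⟨s, hs0, hs1, hqs⟩ := (mem_edgeSeg_iff (hE _ _ huv)).1 hq₁
  obtain ⟨t, ht0, ht1, hqt⟩ := (mem_edgeSeg_iff (hE _ _ hwx)).1 hq₂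
  obtain ⟨hx, hy⟩ := Prod.mk.inj (hqs.symm.trans hqt)
  have hparam : (s = 0 ∨ s = 1) ∧ (t = 0 ∨ t = 1) := by
    rcases lt_trichotomy (lv u) (lv w) with hlt | heq | hgt
    · have : (lv u : ℝ) + 1 ≤ lv w := by exact_mod_cast hlt
      exact ⟨Or.inr (by linarith), Or.inl (by linarith)⟩
    · obtain rfl : s = t := by rw [heq] at hy; linarith
      have := hemb.param_eq_zero_or_one hΓ hE huv hwx hne heq hs0 hs1 hx
      exact ⟨this, this⟩
    · have : (lv w : ℝ) + 1 ≤ lv u := by exact_mod_cast hgt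
      exact ⟨Or.inl (by linarith), Or.inr (by linarith)⟩
  have hend : ∀ {a b : V} {r : ℝ}, E a b → q = ((1 - r) * Γ a + r * Γ b, (lv a : ℝ) + r) →
      r = 0 ∨ r = 1 → q = levelPt Γ lv a ∨ q = levelPt Γ lv b := by
    rintro a b r hab hq (rfl | rfl)
    · left; simp [hq, levelPt]
    · right; simp [hq, levelPt, hE _ _ hab]
  exact ⟨hend huv hqs hparam.1, hend hwx hqt hparam.2⟩

theorem IsDistanceLabeling.isLamDrawing [Finite V] (hemb : IsLevelEmbedding E lv emb)
    (hE : ∀ u v, E u v → lv v = lv u + 1) {x : V → ℤ} (hx : IsDistanceLabeling E emb lam x) :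
    IsLamDrawing E lv emb lam x := by
  have hlt : ∀ u v, emb u v → x u < x v := fun u v h => hx.lt_of_emb hemb h
  refine ⟨fun u v h => hemb.emb_iff_lt hlt h, fun u v e => ?_,
    hemb.levelPlanar (fun u v h => Int.cast_lt.2 (hlt u v h)) hE⟩
  have := hx.1 u v e
  omega

theorem IsLamDrawing.isDistanceLabeling (hemb : IsLevelEmbedding E lv emb) {Γ : V → ℤ}
    (hΓ : IsLamDrawing E lv emb lam Γ) : IsDistanceLabeling E emb lam Γ := by
  refine ⟨fun u v e => ?_, fun u v c => ?_⟩
  · have := hΓ.2.1 u v e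
    omega
  · have := (hΓ.1 u v (hemb.same_level _ _ c.1)).1 c.1
    omega

end ConstraintDigraph

/-- Suppose the rightmost vertices of the levels of an embedded proper
level-planar graph form a directed path `p 1, p 2, …, p k` with one vertex on each level,
and let `v_R = p 1`.  Then every vertex is reachable from `v_R` by a directed walk in the
constraint digraph `D_G^λ`, and if `D_G^λ` has no directed cycle of negative total length,
then the shortest walk distance `d v` from `v_R` is well-defined for every vertex `v`, `d`
is a distance labeling of `D_G^λ` (so `v ↦ (d v, ℓ v)` is a λ-drawing), and every distance
labeling `x` with `x v_R = 0` — in particular every λ-drawing `Γ` with `Γ v_R = 0` —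
satisfies `x v ≤ d v` for all `v`; i.e., `d` describes the λ-rightmost drawing. -/
theorem statement8 {V : Type*} [Fintype V] (E : V → V → Prop) (lv : V → ℕ) (k : ℕ)
    (hk : 1 ≤ k)
    (hlv : ∀ v, 1 ≤ lv v ∧ lv v ≤ k)
    (hE : ∀ u v, E u v → lv v = lv u + 1)
    (emb : V → V → Prop) (hemb : IsLevelEmbedding E lv emb)
    (lam : ℕ) (hlam : 1 ≤ lam)
    (p : ℕ → V)
    (hplevel : ∀ i, 1 ≤ i → i ≤ k → lv (p i) = i)
    (hppath : ∀ i, 1 ≤ i → i < k → E (p i) (p (i + 1)))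
    (hpright : ∀ i v, 1 ≤ i → i ≤ k → lv v = i → v ≠ p i → emb v (p i)) :
    (∀ v : V, ∃ (n : ℕ) (L : ℤ), DWalk E emb lam (p 1) v n L) ∧
    (NoNegCycle E emb lam →
      ∃ d : V → ℤ,
        (∀ v : V, IsLeast {L : ℤ | ∃ n : ℕ, DWalk E emb lam (p 1) v n L} (d v)) ∧
        IsDistanceLabeling E emb lam d ∧
        IsLamDrawing E lv emb lam d ∧
        (∀ x : V → ℤ, IsDistanceLabeling E emb lam x → x (p 1) = 0 → ∀ v, x v ≤ d v) ∧
        (∀ Γ : V → ℤ, IsLamDrawing E lv emb lam Γ → Γ (p 1) = 0 → ∀ v, Γ v ≤ d v)) := by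
  have hpath : ∀ i, 1 ≤ i → i ≤ k → ∃ n L, DWalk E emb lam (p 1) (p i) n L := by
    intro i hi
    induction i, hi using Nat.le_induction with
    | base => exact fun _ => ⟨_, _, .refl _⟩
    | succ i hi ih =>
      intro hik
      obtain ⟨_, _, hd⟩ := ih (by omega)
      exact ⟨_, _, hd.edgeFwd (hppath i hi (by omega))⟩
  have hreach : ∀ v : V, ∃ (n : ℕ) (L : ℤ), DWalk E emb lam (p 1) v n L := by
    intro v
    obtain ⟨hv1, hvk⟩ := hlv v
    obtain ⟨n, L, hd⟩ := hpath (lv v) hv1 hvk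
    by_cases hv : v = p (lv v)
    · rw [hv]
      exact ⟨n, L, hd⟩
    · exact exists_dWalk_of_emb hemb hd v (hpright _ v hv1 hvk rfl hv)
  refine ⟨hreach, fun hneg => ?_⟩
  have hleast : ∀ v, ∃ m, IsLeast {L : ℤ | ∃ n : ℕ, DWalk E emb lam (p 1) v n L} m := by
    intro v
    obtain ⟨n, L, hd⟩ := hreach v
    obtain ⟨m, hm, hmin⟩ := Int.exists_least_of_bdd
      (P := fun L => ∃ n : ℕ, DWalk E emb lam (p 1) v n L)
      ⟨_, fun _ ⟨_, hz⟩ => hz.neg_card_le hlam hneg⟩ ⟨L, n, hd⟩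
    exact ⟨m, hm, hmin⟩
  choose d hd using hleast
  have hlabel : IsDistanceLabeling E emb lam d := by
    refine isDistanceLabeling_iff.2 fun a b l harc => ?_
    obtain ⟨n, hwalk⟩ := (hd a).1
    exact (hd b).2 ⟨_, hwalk.snoc harc⟩
  have hmax : ∀ x : V → ℤ, IsDistanceLabeling E emb lam x → x (p 1) = 0 → ∀ v, x v ≤ d v := by
    intro x hx hx0 v
    obtain ⟨n, hwalk⟩ := (hd v).1
    have := hx.le_add_of_walk hwalk
    omega
  exact ⟨d, hd, hlabel, hlabel.isLamDrawing hemb hE, hmax,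
    fun Γ hΓ => hmax Γ (hΓ.isDistanceLabeling hemb)⟩
end

section
/- Let a, b, c, d ∈ ℝ with (a, b) ≠ (c, d). The closed straight-line segment in ℝ² from (a, 0) to (b, 1) and the closed straight-line segment from (c, 0) to (d, 1) intersect in a point that is not a common endpoint of the two segments if and only if (a − c)(b − d) < 0. -/
/-- A point lies on the segment from `(a, 0)` to `(b, 1)` iff its height lies in `[0, 1]` and its
abscissa is the corresponding interpolation between `a` and `b`. -/
theorem mem_segment_zero_one_iff (a b : ℝ) (p : ℝ × ℝ) :
    p ∈ segment ℝ (a, (0 : ℝ)) (b, (1 : ℝ)) ↔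
      0 ≤ p.2 ∧ p.2 ≤ 1 ∧ p.1 = (1 - p.2) * a + p.2 * b := by
  obtain ⟨x, y⟩ := p
  constructor
  · rintro ⟨s, t, hs, ht, hst, hp⟩
    simp only [Prod.smul_mk, Prod.mk_add_mk, smul_eq_mul, Prod.mk.injEq, mul_zero, mul_one,
      zero_add] at hp
    obtain ⟨rfl, rfl⟩ := hp
    obtain rfl : s = 1 - t := by linarith
    exact ⟨ht, by linarith, rfl⟩
  · rintro ⟨h0, h1, hx⟩
    refine ⟨1 - y, y, sub_nonneg.2 h1, h0, by ring, ?_⟩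
    simpa using hx.symm

/-- For `(a, b) ≠ (c, d)`, the closed segments in `ℝ²` from `(a, 0)` to
`(b, 1)` and from `(c, 0)` to `(d, 1)` intersect in a point that is not a common endpoint
of the two segments if and only if `(a - c)(b - d) < 0`. -/
theorem statement12 (a b c d : ℝ) (h : (a, b) ≠ (c, d)) :
    (∃ p : ℝ × ℝ,
        p ∈ segment ℝ (a, (0 : ℝ)) (b, (1 : ℝ)) ∧
        p ∈ segment ℝ (c, (0 : ℝ)) (d, (1 : ℝ)) ∧
        ¬ ((p = (a, (0 : ℝ)) ∨ p = (b, (1 : ℝ))) ∧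
           (p = (c, (0 : ℝ)) ∨ p = (d, (1 : ℝ))))) ↔
      (a - c) * (b - d) < 0 := by
  simp only [mem_segment_zero_one_iff]
  constructor
  · rintro ⟨⟨x, t⟩, ⟨h0, h1, hx⟩, ⟨-, -, hx'⟩, hne⟩
    dsimp only at h0 h1 hx hx'
    have ht0 : 0 < t := by
      refine h0.lt_of_ne fun ht => hne ?_
      subst ht
      exact ⟨Or.inl (by simpa using hx), Or.inl (by simpa using hx')⟩
    have ht1 : t < 1 := by
      refine h1.lt_of_ne fun ht => hne ?_
      subst ht
      exact ⟨Or.inr (by simpa using hx), Or.inr (by simpa using hx')⟩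
    have hcross : (1 - t) * (a - c) = -(t * (b - d)) := by linarith
    by_contra! hnonneg
    have hac : a - c = 0 := by
      have hsq : (1 - t) * (a - c) ^ 2 = -(t * ((a - c) * (b - d))) := by
        linear_combination (a - c) * hcross
      have hle : (1 - t) * (a - c) ^ 2 ≤ 0 := by
        rw [hsq]
        exact neg_nonpos.2 (mul_nonneg h0 hnonneg)
      have := nonpos_of_mul_nonpos_right hle (sub_pos.2 ht1)
      exact pow_eq_zero_iff two_ne_zero |>.1 (this.antisymm (sq_nonneg _))
    have hbd : b - d = 0 := by
      rw [hac, mul_zero, eq_comm, neg_eq_zero] at hcross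
      exact (mul_eq_zero.1 hcross).resolve_left ht0.ne'
    exact h (Prod.ext (sub_eq_zero.1 hac) (sub_eq_zero.1 hbd))
  · intro hneg
    -- The crossing point has height `(a - c) / ((a - c) - (b - d))`.
    obtain ⟨t, ht0, ht1, ht⟩ : ∃ t : ℝ, 0 < t ∧ t < 1 ∧ t * ((a - c) - (b - d)) = a - c := by
      rcases mul_neg_iff.1 hneg with ⟨hac, hbd⟩ | ⟨hac, hbd⟩
      · have hpos : 0 < (a - c) - (b - d) := by linarith
        exact ⟨_, div_pos hac hpos, (div_lt_one hpos).2 (by linarith),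
          div_mul_cancel₀ _ hpos.ne'⟩
      · have hlt : (a - c) - (b - d) < 0 := by linarith
        exact ⟨_, div_pos_of_neg_of_neg hac hlt, (div_lt_one_of_neg hlt).2 (by linarith),
          div_mul_cancel₀ _ hlt.ne⟩
    refine ⟨((1 - t) * a + t * b, t), ⟨ht0.le, ht1.le, rfl⟩, ⟨ht0.le, ht1.le, ?_⟩, ?_⟩
    · linear_combination -ht
    · simp [ht0.ne', ht1.ne]
end
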